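/- Fix p > 0 and nonnegative weights w_{ij}, 1 ≤ i, j ≤ d. Let Q be a probability distribution on ℝ^d with E_{Y∼Q}|Y_i − Y_j|^p < ∞ for all pairs i, j, with E_{Y∼Q}|Y_i − Y_j|^p < ∞ also for the pushforward Q⁻ of Q under x ↦ −x, and suppose Q⁻ ≠ Q. Then, setting P = Q⁻, one has P ≠ Q but the expected variogram scores coincide: S_v^(p)(P, Q) = S_v^(p)(Q, Q). Consequently the variogram score is not strictly proper relative to any class of distributions containing both Q and Q⁻. -/

import Mathlib

open MeasureTheory

/-- The `p`-th absolute moment of a coordinate difference is invariant under `x ↦ -x`. -/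
theorem integral_abs_sub_rpow_map_neg {ι : Type*} (Q : Measure (ι → ℝ)) (p : ℝ) (i j : ι) :
    ∫ x, |x i - x j| ^ p ∂(Q.map fun x => -x) = ∫ x, |x i - x j| ^ p ∂Q := by
  refine (integral_map_equiv (MeasurableEquiv.neg (ι → ℝ)) _).trans ?_
  refine integral_congr_ae (.of_forall fun x => ?_)
  simp [neg_add_eq_sub, abs_sub_comm (x j)]

/-- The variogram score is not strictly proper: for `Q` with `Q⁻ ≠ Q` (where `Q⁻` is the
pushforward of `Q` under `x ↦ -x`), taking `P = Q⁻` gives `P ≠ Q` while the expected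
variogram scores coincide: `S_v(P, Q) = S_v(Q, Q)`. -/
theorem variogram_score_not_strictly_proper
    {d : ℕ} (p : ℝ) (hp : 0 < p)
    (w : Fin d → Fin d → ℝ) (hw : ∀ i j, 0 ≤ w i j)
    (Q : Measure (Fin d → ℝ)) [IsProbabilityMeasure Q]
    -- E_{Y∼Q} |Y_i − Y_j|^p < ∞ for all pairs i, j
    (hmomQ : ∀ i j, Integrable (fun x => |x i - x j| ^ p) Q)
    -- the same moments are finite for the pushforward Q⁻ of Q under x ↦ -x
    (hmomQneg : ∀ i j, Integrable (fun x => |x i - x j| ^ p) (Q.map fun x => -x))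
    -- Q⁻ ≠ Q
    (hne : (Q.map fun x => -x) ≠ Q) :
    -- P := Q⁻ satisfies P ≠ Q but S_v(P, Q) = S_v(Q, Q)
    (Q.map fun x => -x) ≠ Q ∧
      ∫ y, (∑ i, ∑ j, w i j *
            (|y i - y j| ^ p - ∫ x, |x i - x j| ^ p ∂(Q.map fun x => -x)) ^ 2) ∂Q
        = ∫ y, (∑ i, ∑ j, w i j *
            (|y i - y j| ^ p - ∫ x, |x i - x j| ^ p ∂Q) ^ 2) ∂Q := by
  exact ⟨hne, by simp only [integral_abs_sub_rpow_map_neg]⟩
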